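/- Let v₁, v₂ be a basis of a full-rank lattice L in ℝ² × {0} ⊂ ℝ³, let c > 0, let Λ be the lattice generated by v₁, v₂ and (0,0,c), let S be the covolume of L, and define, for t > 0, P(t) = ((Sc/2)/(4πt)^{3/2}) ∑_{v∈Λ} e^{−‖v‖²/(4t)} + (S/(8πt)) ∑_{(m,n)∈ℤ²} e^{−‖(m + 1/2)v₁ + n v₂‖²/(4t)}. If two such data sets (v₁, v₂, c) and (v₁', v₂', c') (with lattices L, L') yield P(t) = P'(t) for all t > 0, then c = c' and there exists a linear isometry O of ℝ² with O(L) = L' and O(v₁/2) ∈ v₁'/2 + L'. -/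

import Mathlib

open Real

/-- Orthogonal projection `ℝ³ → ℝ²` onto the first two coordinates, identifying the plane
`ℝ² × {0}` with `ℝ²`. -/
noncomputable def planeProj (v : EuclideanSpace ℝ (Fin 3)) : EuclideanSpace ℝ (Fin 2) :=
  (WithLp.equiv 2 (Fin 2 → ℝ)).symm ![v 0, v 1]

/-- The trace function `tr(H_{N₁})` of the non-orientable flat 3-manifold `N₁`, whose covering
torus lattice is generated by the plane vectors `v₁, v₂` and the orthogonal vector `(0,0,c)`;
`S = |v₁ 0 * v₂ 1 − v₁ 1 * v₂ 0|` is the covolume of the plane lattice generated by `v₁, v₂`,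
and `vol(N₁) = S c / 2` (Theorem A). -/
noncomputable def N1trace (v₁ v₂ : EuclideanSpace ℝ (Fin 3)) (c t : ℝ) : ℝ :=
  (|v₁ 0 * v₂ 1 - v₁ 1 * v₂ 0| * c / 2) / (4 * π * t) ^ ((3:ℝ)/2) *
    (∑' v : (Submodule.span ℤ
        ({v₁, v₂, c • EuclideanSpace.single 2 1} : Set (EuclideanSpace ℝ (Fin 3)))),
      Real.exp (-‖(v : EuclideanSpace ℝ (Fin 3))‖ ^ 2 / (4 * t))) +
  |v₁ 0 * v₂ 1 - v₁ 1 * v₂ 0| / (8 * π * t) *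
    (∑' p : ℤ × ℤ, Real.exp (-‖((p.1 : ℝ) + 1/2) • v₁ + (p.2 : ℝ) • v₂‖ ^ 2 / (4 * t)))

section

open Filter Topology
open scoped RealInnerProductSpace

lemma tendsto_exp_mul_tsum {ι : Type*} {w q : ι → ℝ} (hq : ∀ R, {i | q i ≤ R}.Finite)
    (hs : ∀ s : ℝ, 0 < s → Summable fun i => w i * rexp (-s * q i)) {r : ℝ}
    (h0 : ∀ y < r, ∑' i, (if q i = y then w i else 0) = 0) :
    Tendsto (fun s : ℝ => rexp (s * r) * ∑' i, w i * rexp (-s * q i)) atTop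
      (𝓝 (∑' i, if q i = r then w i else 0)) := by
  classical
  have hfin : {i | q i < r}.Finite := (hq r).subset fun i (hi : q i < r) => hi.le
  have key : ∀ s : ℝ, 0 < s → rexp (s * r) * ∑' i, w i * rexp (-s * q i) =
      ∑' i, if q i < r then 0 else w i * rexp (-s * (q i - r)) := by
    intro s hs0
    have hsum : Summable fun i => w i * rexp (-s * (q i - r)) := by
      refine ((hs s hs0).mul_left (rexp (s * r))).congr fun i => ?_
      rw [mul_left_comm, ← Real.exp_add]
      ring_nf
    have hzero : ∑ i ∈ hfin.toFinset, w i * rexp (-s * (q i - r)) = 0 := by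
      rw [← Finset.sum_fiberwise_of_maps_to (t := hfin.toFinset.image q) (g := q)
        (fun i hi => Finset.mem_image_of_mem q hi)]
      refine Finset.sum_eq_zero fun y hy => ?_
      obtain ⟨j, hj, rfl⟩ := Finset.mem_image.1 hy
      have hj' : q j < r := by simpa using hj
      have h1 := h0 _ hj'
      rw [tsum_eq_sum (s := hfin.toFinset)
        (fun i hi => if_neg fun h => hi (by simpa [h] using hj'))] at h1
      rw [← Finset.sum_filter] at h1
      rw [Finset.sum_congr rfl (g := fun i => w i * rexp (-s * (q j - r)))
        (fun i hi => by rw [(Finset.mem_filter.1 hi).2]), ← Finset.sum_mul, h1, zero_mul]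
    have hite : Summable fun i => if q i < r then w i * rexp (-s * (q i - r)) else 0 :=
      summable_of_ne_finset_zero (s := hfin.toFinset) fun i hi => if_neg (by simpa using hi)
    have hz2 : ∑' i, (if q i < r then w i * rexp (-s * (q i - r)) else 0) = 0 := by
      rw [tsum_eq_sum (s := hfin.toFinset) (fun i hi => if_neg (by simpa using hi)), ← hzero]
      exact Finset.sum_congr rfl fun i hi => if_pos (by simpa using hi)
    rw [← tsum_mul_left]
    calc ∑' i, rexp (s * r) * (w i * rexp (-s * q i))
        = ∑' i, w i * rexp (-s * (q i - r)) := by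
          refine tsum_congr fun i => ?_
          rw [mul_left_comm, ← Real.exp_add]
          ring_nf
      _ = ∑' i, w i * rexp (-s * (q i - r)) -
          ∑' i, (if q i < r then w i * rexp (-s * (q i - r)) else 0) := by rw [hz2, sub_zero]
      _ = _ := by
          rw [← hsum.tsum_sub hite]
          refine tsum_congr fun i => ?_
          split_ifs <;> ring
  have hlim : Tendsto (fun s : ℝ => ∑' i, if q i < r then 0 else w i * rexp (-s * (q i - r))) atTop
      (𝓝 (∑' i, if q i = r then w i else 0)) := by
    refine tendsto_tsum_of_dominated_convergence
      (bound := fun i => rexp r * ‖w i * rexp (-1 * q i)‖) ((hs 1 one_pos).norm.mul_left _) ?_ ?_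
    · intro i
      rcases lt_trichotomy (q i) r with h | h | h
      · simp [h, h.ne]
      · simp [h]
      · simp only [h.not_gt, h.ne', if_false]
        have : Tendsto (fun s : ℝ => rexp (-s * (q i - r))) atTop (𝓝 0) := by
          refine Real.tendsto_exp_atBot.comp ?_
          exact tendsto_neg_atTop_atBot.atBot_mul_const (sub_pos.2 h)
        simpa using this.const_mul (w i)
    · filter_upwards [eventually_ge_atTop 1] with s hs1 i
      split_ifs with h
      · simp; positivity
      · rw [norm_mul, norm_mul, mul_left_comm, Real.norm_eq_abs (rexp _), Real.norm_eq_abs (rexp _),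
          abs_of_pos (Real.exp_pos _), abs_of_pos (Real.exp_pos _), ← Real.exp_add]
        gcongr
        nlinarith [not_lt.1 h]
  refine hlim.congr' ?_
  filter_upwards [eventually_gt_atTop 0] with s hs0 using (key s hs0).symm

lemma exists_next_value {ι : Type*} {q : ι → ℝ} (hq : ∀ R, {i | q i ≤ R}.Finite) (r : ℝ) :
    ∃ r' > r, ∀ i, q i < r' → q i ≤ r := by
  have hfin : {i | r < q i ∧ q i ≤ r + 1}.Finite := (hq (r + 1)).subset fun i hi => hi.2
  rcases {i | r < q i ∧ q i ≤ r + 1}.eq_empty_or_nonempty with h | h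
  · refine ⟨r + 1, by linarith, fun i hi => ?_⟩
    by_contra! hc
    exact h.subset (⟨hc, hi.le⟩ : i ∈ {i | r < q i ∧ q i ≤ r + 1})
  · obtain ⟨i₀, h₀, hmin⟩ := Set.exists_min_image _ q hfin h
    refine ⟨q i₀, h₀.1, fun i hi => ?_⟩
    by_contra! hc
    exact (hmin i ⟨hc, (hi.trans_le h₀.2).le⟩).not_gt hi

lemma coeff_eq_zero_of_sqrt_mul_tsum {ι κ : Type*} {w q : ι → ℝ} {w' q' : κ → ℝ}
    (hq : ∀ R, {i | q i ≤ R}.Finite) (hq' : ∀ R, {i | q' i ≤ R}.Finite)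
    (hs : ∀ s : ℝ, 0 < s → Summable fun i => w i * rexp (-s * q i))
    (hs' : ∀ s : ℝ, 0 < s → Summable fun i => w' i * rexp (-s * q' i))
    (h : ∀ s : ℝ, 0 < s → √s * ∑' i, w i * rexp (-s * q i) + ∑' i, w' i * rexp (-s * q' i) = 0)
    (r : ℝ) :
    ∑' i, (if q i = r then w i else 0) = 0 ∧ ∑' i, (if q' i = r then w' i else 0) = 0 := by
  by_contra hr
  let B : Set ℝ := {r | ¬(∑' i, (if q i = r then w i else 0) = 0 ∧
    ∑' i, (if q' i = r then w' i else 0) = 0)}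
  have hB : ∀ y ∈ B, (∃ i, q i = y) ∨ ∃ i, q' i = y := by
    intro y hy
    by_contra! hc
    exact hy ⟨by simp [hc.1], by simp [hc.2]⟩
  have hBfin : (B ∩ Set.Iic r).Finite := by
    refine (((hq r).image q).union ((hq' r).image q')).subset ?_
    rintro y ⟨hy, hyr⟩
    rcases hB y hy with ⟨i, rfl⟩ | ⟨i, rfl⟩
    · exact Or.inl ⟨i, hyr, rfl⟩
    · exact Or.inr ⟨i, hyr, rfl⟩
  obtain ⟨m, hm, hmin⟩ := Set.exists_min_image _ id hBfin ⟨r, hr, le_refl r⟩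
  have hlt : ∀ y < m, ∑' i, (if q i = y then w i else 0) = 0 ∧
      ∑' i, (if q' i = y then w' i else 0) = 0 := by
    intro y hy
    by_contra hc
    exact (hmin y ⟨hc, hy.le.trans hm.2⟩).not_gt hy
  have t1 := tendsto_exp_mul_tsum hq hs (r := m) fun y hy => (hlt y hy).1
  have t2 := tendsto_exp_mul_tsum hq' hs' (r := m) fun y hy => (hlt y hy).2
  have c1 : ∑' i, (if q i = m then w i else 0) = 0 := by
    have hz : Tendsto (fun s : ℝ => -(√s)⁻¹ * (rexp (s * m) * ∑' i, w' i * rexp (-s * q' i))) atTop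
        (𝓝 0) := by
      have := (tendsto_inv_atTop_zero.comp Real.tendsto_sqrt_atTop).neg.mul t2
      simpa using this
    refine tendsto_nhds_unique (t1.congr' ?_) hz
    filter_upwards [eventually_gt_atTop 0] with s hs0
    have hs1 : √s ≠ 0 := (Real.sqrt_pos.2 hs0).ne'
    have hsq : (√s)⁻¹ * √s = 1 := inv_mul_cancel₀ hs1
    linear_combination (√s)⁻¹ * rexp (s * m) * h s hs0 -
      rexp (s * m) * (∑' i, w i * rexp (-s * q i)) * hsq
  obtain ⟨m', hm', hgap⟩ := exists_next_value hq m
  have t3 := tendsto_exp_mul_tsum hq hs (r := m') fun y hy => by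
    rcases lt_trichotomy y m with hy' | rfl | hy'
    · exact (hlt y hy').1
    · exact c1
    · have : ∀ i, q i ≠ y := fun i hi => (hgap i (hi ▸ hy)).not_gt (hi ▸ hy')
      simp [this]
  refine hm.1 ⟨c1, ?_⟩
  have hd := tendsto_rpow_mul_exp_neg_mul_atTop_nhds_zero (1 / 2) (m' - m) (sub_pos.2 hm')
  have hz := (hd.mul t3).neg
  rw [zero_mul, neg_zero] at hz
  refine tendsto_nhds_unique (t2.congr' ?_) hz
  filter_upwards [eventually_gt_atTop 0] with s hs0
  have he : rexp (-(m' - m) * s) * rexp (s * m') = rexp (s * m) := by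
    rw [← Real.exp_add]; ring_nf
  rw [← Real.sqrt_eq_rpow]
  linear_combination rexp (s * m) * h s hs0 +
    √s * (∑' i, w i * rexp (-s * q i)) * he

lemma hasSum_ite_eq_ncard {ι : Type*} {q : ι → ℝ} (hq : ∀ R, {i | q i ≤ R}.Finite) (K r : ℝ) :
    HasSum (fun i => if q i = r then K else 0) (K * {i | q i = r}.ncard) := by
  have hf : {i | q i = r}.Finite := (hq r).subset fun i hi => le_of_eq hi
  have h : HasSum (fun i => if q i = r then K else 0)
      (∑ i ∈ hf.toFinset, if q i = r then K else 0) :=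
    hasSum_sum_of_ne_finset_zero fun i hi => if_neg (by simpa using hi)
  rw [Finset.sum_congr rfl (g := fun _ => K) (fun i hi => if_pos (by simpa using hi))] at h
  rwa [Finset.sum_const, nsmul_eq_mul, mul_comm, ← Set.ncard_eq_toFinset_card _ hf] at h

lemma finite_le_of_summable_exp {ι : Type*} {q : ι → ℝ} (h : Summable fun i => rexp (-1 * q i))
    (R : ℝ) : {i | q i ≤ R}.Finite := by
  have := h.tendsto_cofinite_zero.eventually_lt_const (Real.exp_pos (-R))
  refine Set.Finite.subset this fun i hi => ?_
  simpa using hi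

lemma finite_sumElim_le {ι ι' : Type*} {q : ι → ℝ} {q' : ι' → ℝ}
    (hq : ∀ R, {i | q i ≤ R}.Finite) (hq' : ∀ R, {i | q' i ≤ R}.Finite) (R : ℝ) :
    {i | Sum.elim q q' i ≤ R}.Finite := by
  refine (((hq R).image Sum.inl).union ((hq' R).image Sum.inr)).subset ?_
  rintro (i | i) hi
  · exact Or.inl ⟨i, hi, rfl⟩
  · exact Or.inr ⟨i, hi, rfl⟩

lemma hasSum_sumElim_exp {ι ι' : Type*} {q : ι → ℝ} {q' : ι' → ℝ} {s : ℝ}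
    (hq : Summable fun i => rexp (-s * q i)) (hq' : Summable fun i => rexp (-s * q' i))
    (K K' : ℝ) :
    HasSum (fun i => Sum.elim (fun _ => K) (fun _ => -K') i * rexp (-s * Sum.elim q q' i))
      (K * ∑' i, rexp (-s * q i) - K' * ∑' i, rexp (-s * q' i)) := by
  rw [sub_eq_add_neg, ← neg_mul]
  exact HasSum.sum (hq.hasSum.mul_left K) (hq'.hasSum.mul_left (-K'))

lemma tsum_sumElim_ite {ι ι' : Type*} {q : ι → ℝ} {q' : ι' → ℝ}
    (hq : ∀ R, {i | q i ≤ R}.Finite) (hq' : ∀ R, {i | q' i ≤ R}.Finite) (K K' r : ℝ) :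
    ∑' i, (if Sum.elim q q' i = r then Sum.elim (fun _ => K) (fun _ => -K') i else 0) =
      K * {i | q i = r}.ncard - K' * {i | q' i = r}.ncard := by
  rw [sub_eq_add_neg, ← neg_mul]
  refine HasSum.tsum_eq (HasSum.sum ?_ ?_)
  · exact hasSum_ite_eq_ncard hq K r
  · exact hasSum_ite_eq_ncard hq' (-K') r

/-- Two combinations of theta series with different powers of `s` in front determine the weighted
number of times each exponent occurs. -/
lemma ncard_eq_of_theta_eq {ι ι' κ κ' : Type*} {q : ι → ℝ} {q' : ι' → ℝ} {p : κ → ℝ} {p' : κ' → ℝ}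
    (hq : ∀ s : ℝ, 0 < s → Summable fun i => rexp (-s * q i))
    (hq' : ∀ s : ℝ, 0 < s → Summable fun i => rexp (-s * q' i))
    (hp : ∀ s : ℝ, 0 < s → Summable fun i => rexp (-s * p i))
    (hp' : ∀ s : ℝ, 0 < s → Summable fun i => rexp (-s * p' i)) {K K' S S' : ℝ}
    (h : ∀ s : ℝ, 0 < s →
      √s * (K * ∑' i, rexp (-s * q i)) + S * ∑' i, rexp (-s * p i) =
      √s * (K' * ∑' i, rexp (-s * q' i)) + S' * ∑' i, rexp (-s * p' i)) (r : ℝ) :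
    K * {i | q i = r}.ncard = K' * {i | q' i = r}.ncard ∧
      S * {i | p i = r}.ncard = S' * {i | p' i = r}.ncard := by
  have fq := finite_le_of_summable_exp (hq 1 one_pos)
  have fq' := finite_le_of_summable_exp (hq' 1 one_pos)
  have fp := finite_le_of_summable_exp (hp 1 one_pos)
  have fp' := finite_le_of_summable_exp (hp' 1 one_pos)
  have key := coeff_eq_zero_of_sqrt_mul_tsum (finite_sumElim_le fq fq') (finite_sumElim_le fp fp')
    (fun s hs => (hasSum_sumElim_exp (hq s hs) (hq' s hs) K K').summable)
    (fun s hs => (hasSum_sumElim_exp (hp s hs) (hp' s hs) S S').summable)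
    (fun s hs => by
      rw [(hasSum_sumElim_exp (hq s hs) (hq' s hs) K K').tsum_eq,
        (hasSum_sumElim_exp (hp s hs) (hp' s hs) S S').tsum_eq]
      linear_combination h s hs) r
  rw [tsum_sumElim_ite fq fq', tsum_sumElim_ite fp fp'] at key
  exact ⟨sub_eq_zero.1 key.1, sub_eq_zero.1 key.2⟩

/-- The values of a positive definite binary form at `(x, y)` with `x` odd. -/
noncomputable def halfForm (W g U : ℝ) (p : ℤ × ℤ) : ℝ :=
  W * (2 * p.1 + 1) ^ 2 - 2 * g * (2 * p.1 + 1) * p.2 + U * p.2 ^ 2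

/-- The restriction of a binary form to `2ℤ × ℤ`, plus an orthogonal square. -/
noncomputable def torusForm (W g U C : ℝ) (p : ℤ × ℤ × ℤ) : ℝ :=
  4 * W * p.1 ^ 2 - 4 * g * p.1 * p.2.1 + U * p.2.1 ^ 2 + C * p.2.2 ^ 2

lemma one_le_intCast_sq {n : ℤ} (hn : n ≠ 0) : (1 : ℝ) ≤ (n : ℝ) ^ 2 := by
  have : 0 < n ^ 2 := by positivity
  exact_mod_cast this

lemma one_le_odd_sq (n : ℤ) : (1 : ℝ) ≤ (2 * n + 1) ^ 2 := by
  exact_mod_cast one_le_intCast_sq (n := 2 * n + 1) (by omega)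

lemma odd_sq_eq_one_or (n : ℤ) :
    (2 * n + 1 : ℝ) ^ 2 = 1 ∧ (n = 0 ∨ n = -1) ∨ (9 : ℝ) ≤ (2 * n + 1) ^ 2 := by
  by_cases h : n = 0 ∨ n = -1
  · left
    refine ⟨?_, h⟩
    rcases h with rfl | rfl <;> norm_num
  · right
    have : (9 : ℤ) ≤ (2 * n + 1) ^ 2 := by
      rcases le_or_gt 1 n with h1 | h1
      · nlinarith
      · have : n ≤ -2 := by omega
        nlinarith
    exact_mod_cast this

lemma four_le_even_sq {n : ℤ} (hn : n ≠ 0) (h2 : 2 ∣ n) : (4 : ℝ) ≤ (n : ℝ) ^ 2 := by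
  obtain ⟨k, rfl⟩ := h2
  have := one_le_intCast_sq (n := k) (by rintro rfl; simp at hn)
  push_cast
  linarith

lemma halfForm_zero_right (W g U : ℝ) (x : ℤ) : halfForm W g U (x, 0) = W * (2 * x + 1) ^ 2 := by
  simp [halfForm]

/-- The form `W x² - 2 g x y + U y²` is positive definite and `W` is its minimum at the points
`(x, y)` with `x` odd. -/
structure IsHalfReduced (W g U : ℝ) : Prop where
  nonneg : 0 ≤ g
  le : g ≤ W
  two_mul_le : 2 * g ≤ U
  det_pos : 0 < W * U - g ^ 2

namespace IsHalfReduced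

variable {W g U : ℝ}

lemma pos (h : IsHalfReduced W g U) : 0 < W := by
  have := h.nonneg
  have := h.det_pos
  rcases (h.nonneg.trans h.le).lt_or_eq with h0 | h0
  · exact h0
  · rw [← h0, zero_mul] at this
    nlinarith [sq_nonneg g]

lemma le_halfForm_of_ne (h : IsHalfReduced W g U) {p : ℤ × ℤ} (hp : p.2 ≠ 0) :
    W - 2 * g + U ≤ halfForm W g U p := by
  obtain ⟨x, y⟩ := p
  have h1 := one_le_odd_sq x
  have h2 : (1 : ℝ) ≤ (y : ℝ) ^ 2 := one_le_intCast_sq hp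
  simp only [halfForm]
  nlinarith [mul_nonneg (sub_nonneg.2 h.le) (sub_nonneg.2 h1),
    mul_nonneg (sub_nonneg.2 h.two_mul_le) (sub_nonneg.2 h2),
    mul_nonneg h.nonneg (add_nonneg (sq_nonneg ((2 * x + 1 : ℝ) - y)) (sub_nonneg.2 h2))]

lemma le_halfForm (h : IsHalfReduced W g U) (p : ℤ × ℤ) : W ≤ halfForm W g U p := by
  by_cases hp : p.2 = 0
  · obtain ⟨x, y⟩ := p
    obtain rfl : y = 0 := hp
    rw [halfForm_zero_right]
    nlinarith [h.pos, one_le_odd_sq x]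
  · linarith [h.le_halfForm_of_ne hp, h.two_mul_le]

lemma ncard_halfForm_of_lt (h : IsHalfReduced W g U) (hU : 2 * g < U) :
    {p | halfForm W g U p = W}.ncard = 2 := by
  have : {p | halfForm W g U p = W} = {((0 : ℤ), (0 : ℤ)), (-1, 0)} := by
    ext ⟨x, y⟩
    simp only [Set.mem_ofPred_eq, Set.mem_insert_iff, Set.mem_singleton_iff, Prod.mk.injEq]
    constructor
    · intro hp
      obtain rfl : y = 0 := by
        by_contra hy
        linarith [h.le_halfForm_of_ne (p := (x, y)) hy]
      rw [halfForm_zero_right] at hp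
      rcases odd_sq_eq_one_or x with ⟨-, hx⟩ | hx
      · tauto
      · nlinarith [h.pos]
    · rintro (⟨rfl, rfl⟩ | ⟨rfl, rfl⟩) <;> norm_num [halfForm]
  rw [this, Set.ncard_pair (by simp)]

lemma ncard_halfForm_of_eq (h : IsHalfReduced W g U) (hU : U = 2 * g) :
    {p | halfForm W g U p = W}.ncard = 4 := by
  have hg : 0 < g := by
    rcases h.nonneg.lt_or_eq with h0 | h0
    · exact h0
    · have := h.det_pos
      rw [hU, ← h0] at this
      norm_num at this
  have : {p | halfForm W g U p = W} =
      (({((0 : ℤ), (0 : ℤ)), (-1, 0), (0, 1), (-1, -1)} : Finset (ℤ × ℤ)) : Set (ℤ × ℤ)) := by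
    ext ⟨x, y⟩
    simp only [Set.mem_ofPred_eq, Finset.coe_insert, Finset.coe_singleton, Set.mem_insert_iff,
      Set.mem_singleton_iff, Prod.mk.injEq]
    constructor
    · intro hp
      have hsq : halfForm W g U (x, y) - W =
          (W - g) * ((2 * x + 1) ^ 2 - 1) + g * (((2 * x + 1 : ℝ) - y) ^ 2 + y ^ 2 - 1) := by
        simp only [halfForm, hU]
        ring
      rw [hp, sub_self] at hsq
      have h1 := mul_nonneg (sub_nonneg.2 h.le) (sub_nonneg.2 (one_le_odd_sq x))
      have h3 : ((2 * x + 1 : ℝ) - y) ^ 2 + y ^ 2 - 1 ≤ 0 := by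
        by_contra! h4
        nlinarith [mul_pos hg h4]
      have h4 : (2 * x + 1 - y) ^ 2 + y ^ 2 ≤ 1 := by
        have : ((2 * x + 1 : ℝ) - y) ^ 2 + y ^ 2 ≤ 1 := by linarith
        exact_mod_cast this
      have hy1 : y ≤ 1 := by nlinarith [sq_nonneg (2 * x + 1 - y)]
      have hy2 : -1 ≤ y := by nlinarith [sq_nonneg (2 * x + 1 - y)]
      have hx1 : 2 * x + 1 - y ≤ 1 := by nlinarith [sq_nonneg y]
      have hx2 : -1 ≤ 2 * x + 1 - y := by nlinarith [sq_nonneg y]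
      omega
    · rintro (⟨rfl, rfl⟩ | ⟨rfl, rfl⟩ | ⟨rfl, rfl⟩ | ⟨rfl, rfl⟩) <;>
        · simp only [halfForm, hU]
          push_cast
          ring
  rw [this, Set.ncard_coe_finset]
  rfl

lemma second_le_of_ncard_eq {g' U' : ℝ} (h' : IsHalfReduced W g' U')
    (hfin : ∀ r, {p | halfForm W g U p = r}.Finite)
    (hM : ∀ r, {p | halfForm W g U p = r}.ncard = {p | halfForm W g' U' p = r}.ncard) :
    W - 2 * g' + U' ≤ W - 2 * g + U := by
  by_contra! hlt
  refine (hM (W - 2 * g + U)).not_gt (Set.ncard_lt_ncard ?_ (hfin _))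
  rw [Set.ssubset_iff_of_subset]
  · refine ⟨(0, 1), by simp only [Set.mem_ofPred_eq, halfForm]; push_cast; ring, fun hp => ?_⟩
    linarith [h'.le_halfForm_of_ne (p := (0, 1)) one_ne_zero, Set.mem_ofPred_eq ▸ hp]
  · rintro ⟨x, y⟩ hp
    rw [Set.mem_ofPred_eq] at hp ⊢
    obtain rfl : y = 0 := by
      by_contra hy
      linarith [h'.le_halfForm_of_ne (p := (x, y)) hy]
    rwa [halfForm_zero_right] at hp ⊢

lemma eq_of_ncard_eq {g' U' : ℝ} (h : IsHalfReduced W g U) (h' : IsHalfReduced W g' U')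
    (hfin : ∀ r, {p | halfForm W g U p = r}.Finite)
    (hfin' : ∀ r, {p | halfForm W g' U' p = r}.Finite)
    (hM : ∀ r, {p | halfForm W g U p = r}.ncard = {p | halfForm W g' U' p = r}.ncard)
    (hdet : W * U - g ^ 2 = W * U' - g' ^ 2) : g = g' ∧ U = U' := by
  have h1 := h'.second_le_of_ncard_eq hfin hM
  have h2 := h.second_le_of_ncard_eq hfin' fun r => (hM r).symm
  have hg : g = g' := by
    have : (W - g) ^ 2 = (W - g') ^ 2 := by
      have : U = U' + 2 * g - 2 * g' := by linarith
      subst this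
      linarith
    have := (sq_eq_sq₀ (sub_nonneg.2 h.le) (sub_nonneg.2 h'.le)).1 this
    linarith
  exact ⟨hg, by linarith⟩

lemma eq_or_eq_of_four_mul_det {g' : ℝ} (h : IsHalfReduced W g U)
    (h' : IsHalfReduced W g' (2 * g')) (hU : 2 * g < U) (hg' : 0 < g')
    (hval : ∀ r, (∃ p, halfForm W g U p = r) ↔ ∃ p, halfForm W g' (2 * g') p = r)
    (hdet : W * U - g ^ 2 = 4 * (W * (2 * g') - g' ^ 2)) :
    g = 2 * g' ∧ U = 8 * g' ∨ g = 2 * W - 2 * g' ∧ U = 4 * W := by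
  have hle := h'.le
  have hpos := h.pos
  have h1 : W + 4 * g' ≤ W - 2 * g + U := by
    obtain ⟨⟨x, y⟩, hp⟩ := (hval (W - 2 * g + U)).1
      ⟨(0, 1), by simp only [halfForm]; push_cast; ring⟩
    have hsq : halfForm W g' (2 * g') (x, y) =
        (2 * g' * (2 * (x - y : ℤ) + 1) ^ 2 + (4 * W - 2 * g') * (2 * x + 1) ^ 2) / 4 := by
      simp only [halfForm]
      push_cast
      ring
    rw [hp] at hsq
    have o1 := one_le_odd_sq (x - y)
    have o2 := one_le_odd_sq x
    rcases odd_sq_eq_one_or (x - y) with ⟨e1, -⟩ | e1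
    · rcases odd_sq_eq_one_or x with ⟨e2, -⟩ | e2
      · rw [e1, e2] at hsq
        linarith
      · nlinarith
    · nlinarith
  have h2 : W - 2 * g + U ≤ W + 4 * g' := by
    obtain ⟨⟨x, y⟩, hp⟩ := (hval (W + 4 * g')).2
      ⟨(0, 2), by simp only [halfForm]; push_cast; ring⟩
    by_cases hy : y = 0
    · subst hy
      rw [halfForm_zero_right] at hp
      rcases odd_sq_eq_one_or x with ⟨e, -⟩ | e
      · rw [e] at hp
        linarith
      · nlinarith
    · linarith [h.le_halfForm_of_ne (p := (x, y)) hy]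
  obtain rfl : U = 2 * g + 4 * g' := by linarith
  have : (g - 2 * g') * (2 * W - g - 2 * g') = 0 := by linarith
  rcases mul_eq_zero.1 this with h0 | h0
  · left
    constructor <;> linarith
  · right
    constructor <;> linarith

end IsHalfReduced

lemma false_of_ncard_box_eq {A B C : ℝ} (hA : 0 < A) (hAB : A ≤ B) (hC : 0 < C)
    {i j : ℤ → ℤ → ℤ} (h0 : i 0 0 = 0 ∧ j 0 0 = 0) (hpar : ∀ x y, 2 ∣ i x y - j x y)
    (hinj : ∀ x y x' y', i x y = i x' y' → j x y = j x' y' → x = x' ∧ y = y')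
    {q q' : ℤ × ℤ × ℤ → ℝ}
    (hq : ∀ x y z : ℤ, q (x, y, z) = A * (i x y : ℝ) ^ 2 + B * (j x y : ℝ) ^ 2 + C * (z : ℝ) ^ 2)
    (hq' : ∀ x y z : ℤ, q' (x, y, z) = A * (y : ℝ) ^ 2 + B * (x : ℝ) ^ 2 + 4 * C * (z : ℝ) ^ 2)
    (hfin : ∀ r, {p | q p = r}.Finite) (hfin' : ∀ r, {p | q' p = r}.Finite)
    (hN : ∀ r, {p | q p = r}.ncard = {p | q' p = r}.ncard) : False := by
  have hval : ∀ r, (∃ p, q p = r) ↔ ∃ p, q' p = r := fun r => by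
    have := Set.ncard_pos (hfin r)
    rw [hN, Set.ncard_pos (hfin' r)] at this
    exact this.symm
  have hB : 0 < B := hA.trans_le hAB
  have sqn : ∀ n : ℤ, (0 : ℝ) ≤ (n : ℝ) ^ 2 := fun n => sq_nonneg _
  have hAC : A ≤ C := by
    obtain ⟨⟨x, y, z⟩, hp⟩ := (hval C).1 ⟨(0, 0, 1), by simp [hq, h0]⟩
    rw [hq'] at hp
    by_cases hz : z = 0
    · by_cases hx : x = 0
      · by_cases hy : y = 0
        · simp [hx, hy, hz, hC.ne] at hp
        · nlinarith [one_le_intCast_sq hy, sqn x, sqn z]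
      · nlinarith [one_le_intCast_sq hx, sqn y, sqn z]
    · nlinarith [one_le_intCast_sq hz, sqn x, sqn y]
  have hj : ∀ x y, j x y ≠ 0 → A + B ≤ A * (i x y : ℝ) ^ 2 + B * (j x y : ℝ) ^ 2 := by
    intro x y hjy
    by_cases hi : i x y = 0
    · have := four_le_even_sq hjy (by simpa [hi] using hpar x y)
      nlinarith [sqn (i x y)]
    · nlinarith [one_le_intCast_sq hi, one_le_intCast_sq hjy]
  obtain rfl : A = C := by
    obtain ⟨⟨x, y, z⟩, hp⟩ := (hval A).2 ⟨(0, 1, 0), by simp [hq']⟩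
    rw [hq] at hp
    by_cases hz : z = 0
    · exfalso
      by_cases hjy : j x y = 0
      · by_cases hi : i x y = 0
        · simp [hi, hjy, hz, hA.ne] at hp
        · have := four_le_even_sq hi (by simpa [hjy] using hpar x y)
          nlinarith [sqn (j x y), sqn z]
      · nlinarith [hj x y hjy, sqn z]
    · nlinarith [one_le_intCast_sq hz, sqn (i x y), sqn (j x y)]
  have hT : ∀ x y z, q (x, y, z) = B → j x y = 0 ∧ 2 ∣ i x y := by
    intro x y z hp
    rw [hq] at hp
    have hjy : j x y = 0 := by
      by_contra hjy
      nlinarith [hj x y hjy, sqn z]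
    exact ⟨hjy, by simpa [hjy] using hpar x y⟩
  let f : ℤ × ℤ × ℤ → ℤ × ℤ × ℤ := fun p => (0, p.2.2, i p.1 p.2.1 / 2)
  have hf : Set.InjOn f {p | q p = B} := by
    rintro ⟨x, y, z⟩ hp ⟨x', y', z'⟩ hp' heq
    obtain ⟨hjy, hi⟩ := hT x y z hp
    obtain ⟨hjy', hi'⟩ := hT x' y' z' hp'
    simp only [f, Prod.mk.injEq, true_and] at heq
    obtain ⟨rfl, rfl⟩ := hinj x y x' y' (by omega) (by omega)
    rw [heq.1]
  refine (hN B).not_lt ?_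
  rw [← hf.ncard_image]
  refine Set.ncard_lt_ncard ?_ (hfin' B)
  rw [Set.ssubset_iff_of_subset]
  · refine ⟨(1, 0, 0), by simp [hq'], ?_⟩
    rintro ⟨p, -, hp⟩
    simp [f] at hp
  · rintro _ ⟨⟨x, y, z⟩, hp, rfl⟩
    obtain ⟨hjy, k, hk⟩ := hT x y z hp
    rw [Set.mem_ofPred_eq, hq] at hp
    simp only [f, Set.mem_ofPred_eq, hq', hk]
    rw [← hp, hjy, hk]
    rw [Int.mul_ediv_cancel_left _ two_ne_zero]
    push_cast
    ring

lemma IsHalfReduced.false_of_ncard_eq {W g U g' U' C : ℝ} (h : IsHalfReduced W g U)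
    (h' : IsHalfReduced W g' U') (hC : 0 < C) (hU : 2 * g < U) (hU' : U' = 2 * g')
    (hval : ∀ r, (∃ p, halfForm W g U p = r) ↔ ∃ p, halfForm W g' U' p = r)
    (hdet : W * U - g ^ 2 = 4 * (W * U' - g' ^ 2))
    (hfin : ∀ r, {p | torusForm W g U C p = r}.Finite)
    (hfin' : ∀ r, {p | torusForm W g' U' (4 * C) p = r}.Finite)
    (hN : ∀ r, {p | torusForm W g U C p = r}.ncard = {p | torusForm W g' U' (4 * C) p = r}.ncard) :
    False := by
  subst hU'
  have hg' : 0 < g' := by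
    rcases h'.nonneg.lt_or_eq with h0 | h0
    · exact h0
    · have := h'.det_pos
      rw [← h0] at this
      norm_num at this
  let e : ℤ × ℤ × ℤ ≃ ℤ × ℤ × ℤ :=
    { toFun := fun p => (p.1, p.2.1 + p.1, p.2.2)
      invFun := fun p => (p.1, p.2.1 - p.1, p.2.2)
      left_inv := fun p => by simp
      right_inv := fun p => by simp }
  have he : ∀ r, {p | torusForm W g' (2 * g') (4 * C) p = r} =
      e '' {p | torusForm W g' (2 * g') (4 * C) (e p) = r} := fun r => by
    rw [e.image_eq_preimage_symm]
    simp
  have hfin'' : ∀ r, {p | torusForm W g' (2 * g') (4 * C) (e p) = r}.Finite := fun r => by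
    refine Set.Finite.of_finite_image ?_ e.injective.injOn
    rw [← he]
    exact hfin' r
  have hN' : ∀ r, {p | torusForm W g U C p = r}.ncard =
      {p | torusForm W g' (2 * g') (4 * C) (e p) = r}.ncard := fun r => by
    rw [hN, he, Set.ncard_image_of_injective _ e.injective]
  have hle := h'.le
  have hq' : ∀ x y z : ℤ, torusForm W g' (2 * g') (4 * C) (e (x, y, z)) =
      2 * g' * (y : ℝ) ^ 2 + (4 * W - 2 * g') * (x : ℝ) ^ 2 + 4 * C * (z : ℝ) ^ 2 := fun x y z => by
    simp only [torusForm, e, Equiv.coe_fn_mk]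
    push_cast
    ring
  rcases h.eq_or_eq_of_four_mul_det h' hU hg' hval hdet with ⟨rfl, rfl⟩ | ⟨rfl, rfl⟩
  · refine false_of_ncard_box_eq (A := 2 * g') (B := 4 * W - 2 * g') (by linarith) (by linarith) hC
      (i := fun x y => x - 2 * y) (j := fun x _ => x) (by simp) (fun x y => by simp)
      (fun x y x' y' h1 h2 => by omega) (fun x y z => ?_) hq' hfin hfin'' hN'
    simp only [torusForm]
    push_cast
    ring
  · refine false_of_ncard_box_eq (A := 2 * g') (B := 4 * W - 2 * g') (by linarith) (by linarith) hC
      (i := fun x y => x + y) (j := fun x y => x - y) (by simp)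
      (fun x y => ⟨y, by ring⟩)
      (fun x y x' y' h1 h2 => by omega) (fun x y z => ?_) hq' hfin hfin'' hN'
    simp only [torusForm]
    push_cast
    ring

lemma summable_exp_neg_mul_int_sq {a : ℝ} (ha : 0 < a) :
    Summable fun n : ℤ => rexp (-a * (n : ℝ) ^ 2) := by
  have h : Summable fun n : ℕ => rexp (-a * (n : ℝ) ^ 2) := by
    refine Real.summable_exp_nat_mul_of_ge (neg_lt_zero.2 ha) fun i => ?_
    exact_mod_cast Nat.le_self_pow two_ne_zero i
  refine Summable.of_nat_of_neg (by simpa using h) (by simpa using h)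

lemma summable_exp_binaryForm {a b c s : ℝ} (ha : 0 < a) (hdet : 0 < a * c - b ^ 2) (hs : 0 < s) :
    Summable fun p : ℤ × ℤ =>
      rexp (-s * (a * (p.1 : ℝ) ^ 2 + 2 * b * p.1 * p.2 + c * (p.2 : ℝ) ^ 2)) := by
  have hc : 0 < c := by
    by_contra! hc
    nlinarith [sq_nonneg b]
  obtain ⟨d, hd, hle⟩ : ∃ d > 0, ∀ x y : ℝ,
      d * (x ^ 2 + y ^ 2) ≤ a * x ^ 2 + 2 * b * x * y + c * y ^ 2 := by
    refine ⟨(a * c - b ^ 2) / (a + c), by positivity, fun x y => ?_⟩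
    rw [div_mul_eq_mul_div, div_le_iff₀ (by positivity)]
    nlinarith [sq_nonneg (a * x + b * y), sq_nonneg (b * x + c * y)]
  have hsd : 0 < s * d := mul_pos hs hd
  refine Summable.of_nonneg_of_le (fun _ => (Real.exp_pos _).le) (fun p => ?_)
    ((summable_exp_neg_mul_int_sq hsd).mul_of_nonneg (summable_exp_neg_mul_int_sq hsd)
      (fun _ => (Real.exp_pos _).le) fun _ => (Real.exp_pos _).le)
  rw [← Real.exp_add]
  gcongr
  nlinarith [mul_le_mul_of_nonneg_left (hle p.1 p.2) hs.le]

namespace IsHalfReduced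

variable {W g U : ℝ}

lemma summable_halfForm (h : IsHalfReduced W g U) {s : ℝ} (hs : 0 < s) :
    Summable fun p => rexp (-s * halfForm W g U p) := by
  have hinj : Function.Injective fun p : ℤ × ℤ => (2 * p.1 + 1, p.2) := by
    rintro ⟨x, y⟩ ⟨x', y'⟩ h
    simp only [Prod.mk.injEq] at h ⊢
    omega
  refine ((summable_exp_binaryForm (b := -g) h.pos (by simpa using h.det_pos) hs).comp_injective
    hinj).congr fun p => ?_
  simp only [Function.comp, halfForm]
  push_cast
  ring_nf

lemma summable_torusForm (h : IsHalfReduced W g U) {C s : ℝ} (hC : 0 < C) (hs : 0 < s) :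
    Summable fun p => rexp (-s * torusForm W g U C p) := by
  have h2 := summable_exp_binaryForm (a := 4 * W) (b := -2 * g) (c := U) (by linarith [h.pos])
    (by linarith [h.det_pos]) hs
  have h3 := h2.mul_of_nonneg (summable_exp_neg_mul_int_sq (mul_pos hs hC))
      (fun _ => (Real.exp_pos _).le) fun _ => (Real.exp_pos _).le
  refine ((Equiv.prodAssoc ℤ ℤ ℤ).symm.summable_iff.2 h3).congr fun p => ?_
  simp only [Function.comp, Equiv.prodAssoc_symm_apply, torusForm]
  rw [← Real.exp_add]
  ring_nf

lemma ncard_torusForm_zero (h : IsHalfReduced W g U) {C : ℝ} (hC : 0 < C) :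
    {p | torusForm W g U C p = 0}.ncard = 1 := by
  rw [Set.ncard_eq_one]
  refine ⟨0, ?_⟩
  ext ⟨x, y, z⟩
  simp only [Set.mem_ofPred_eq, Set.mem_singleton_iff, Prod.mk_eq_zero]
  have hW := h.pos
  have hd := h.det_pos
  constructor
  · intro hp
    have hsq : W * torusForm W g U C (x, y, z) =
        (2 * W * x - g * y) ^ 2 + (W * U - g ^ 2) * (y : ℝ) ^ 2 + W * C * (z : ℝ) ^ 2 := by
      simp only [torusForm]
      ring
    rw [hp, mul_zero] at hsq
    have i1 := sq_nonneg (2 * W * x - g * y)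
    have i2 := mul_nonneg hd.le (sq_nonneg (y : ℝ))
    have i3 := mul_nonneg (mul_pos hW hC).le (sq_nonneg (z : ℝ))
    have hy : (y : ℝ) = 0 := by
      have : (W * U - g ^ 2) * (y : ℝ) ^ 2 = 0 := by linarith
      simpa [hd.ne'] using this
    have hz : (z : ℝ) = 0 := by
      have : W * C * (z : ℝ) ^ 2 = 0 := by linarith
      simpa [hW.ne', hC.ne'] using this
    have hx : (x : ℝ) = 0 := by
      have : (2 * W * x - g * y) ^ 2 = 0 := by linarith
      simpa [hy, hW.ne'] using this
    exact ⟨by exact_mod_cast hx, by exact_mod_cast hy, by exact_mod_cast hz⟩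
  · rintro ⟨rfl, rfl, rfl⟩
    simp [torusForm]

lemma min_le_of_exists {W' g' U' : ℝ} (h : IsHalfReduced W g U)
    (hval : ∀ r, (∃ p, halfForm W g U p = r) ↔ ∃ p, halfForm W' g' U' p = r) : W ≤ W' := by
  obtain ⟨p, hp⟩ := (hval W').2 ⟨(0, 0), by simp [halfForm]⟩
  exact (h.le_halfForm p).trans_eq hp

/-- Half-reduced forms with the same trace function coincide. -/
theorem eq_of_theta_eq {W' g' U' c c' S S' : ℝ} (h : IsHalfReduced W g U)
    (h' : IsHalfReduced W' g' U') (hc : 0 < c) (hc' : 0 < c') (hS : 0 < S) (hS' : 0 < S')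
    (hdet : S ^ 2 = 4 * (W * U - g ^ 2)) (hdet' : S' ^ 2 = 4 * (W' * U' - g' ^ 2)) {k : ℝ}
    (hk : k ≠ 0)
    (heq : ∀ s : ℝ, 0 < s →
      √s * (k * (S * c) * ∑' p, rexp (-s * torusForm W g U (c ^ 2) p)) +
        S * ∑' p, rexp (-s * halfForm W g U p) =
      √s * (k * (S' * c') * ∑' p, rexp (-s * torusForm W' g' U' (c' ^ 2) p)) +
        S' * ∑' p, rexp (-s * halfForm W' g' U' p)) :
    c = c' ∧ W = W' ∧ g = g' ∧ U = U' := by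
  have hC : 0 < c ^ 2 := by positivity
  have hC' : 0 < c' ^ 2 := by positivity
  have hf := finite_le_of_summable_exp (h.summable_halfForm one_pos)
  have hf' := finite_le_of_summable_exp (h'.summable_halfForm one_pos)
  have ht := finite_le_of_summable_exp (h.summable_torusForm hC one_pos)
  have ht' := finite_le_of_summable_exp (h'.summable_torusForm hC' one_pos)
  replace hf : ∀ r, {p | halfForm W g U p = r}.Finite := fun r =>
    (hf r).subset fun p hp => le_of_eq hp
  replace hf' : ∀ r, {p | halfForm W' g' U' p = r}.Finite := fun r =>
    (hf' r).subset fun p hp => le_of_eq hp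
  replace ht : ∀ r, {p | torusForm W g U (c ^ 2) p = r}.Finite := fun r =>
    (ht r).subset fun p hp => le_of_eq hp
  replace ht' : ∀ r, {p | torusForm W' g' U' (c' ^ 2) p = r}.Finite := fun r =>
    (ht' r).subset fun p hp => le_of_eq hp
  have key := ncard_eq_of_theta_eq (fun s hs => h.summable_torusForm hC hs)
    (fun s hs => h'.summable_torusForm hC' hs) (fun s hs => h.summable_halfForm hs)
    (fun s hs => h'.summable_halfForm hs) heq
  have hM := fun r => (key r).2
  have hvol : S * c = S' * c' := by
    have := (key 0).1
    rw [h.ncard_torusForm_zero hC, h'.ncard_torusForm_zero hC'] at this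
    simpa [hk] using this
  have hN : ∀ r, {p | torusForm W g U (c ^ 2) p = r}.ncard =
      {p | torusForm W' g' U' (c' ^ 2) p = r}.ncard := fun r => by
    have := (key r).1
    rw [← hvol] at this
    exact_mod_cast mul_left_cancel₀ (mul_ne_zero hk (mul_pos hS hc).ne') this
  have hval : ∀ r, (∃ p, halfForm W g U p = r) ↔ ∃ p, halfForm W' g' U' p = r := fun r => by
    have h1 : 0 < {p | halfForm W g U p = r}.ncard ↔ 0 < {p | halfForm W' g' U' p = r}.ncard := by
      rw [← Nat.cast_pos (α := ℝ), ← mul_pos_iff_of_pos_left hS, hM r, mul_pos_iff_of_pos_left hS',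
        Nat.cast_pos]
    rwa [Set.ncard_pos (hf r), Set.ncard_pos (hf' r)] at h1
  obtain rfl : W = W' := le_antisymm (h.min_le_of_exists hval)
    (h'.min_le_of_exists fun r => (hval r).symm)
  have hMW := hM W
  have hSS : S = S' := by
    rcases h.two_mul_le.lt_or_eq with hU | hU <;> rcases h'.two_mul_le.lt_or_eq with hU' | hU'
    · rw [h.ncard_halfForm_of_lt hU, h'.ncard_halfForm_of_lt hU'] at hMW
      push_cast at hMW
      linarith
    · exfalso
      rw [h.ncard_halfForm_of_lt hU, h'.ncard_halfForm_of_eq hU'.symm] at hMW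
      push_cast at hMW
      obtain rfl : S = 2 * S' := by linarith
      obtain rfl : c' = 2 * c := mul_left_cancel₀ hS'.ne' (by linarith)
      have hcc : (2 * c) ^ 2 = 4 * c ^ 2 := by ring
      rw [hcc] at ht' hN
      exact h.false_of_ncard_eq h' hC hU hU'.symm hval (by linarith) ht ht' hN
    · exfalso
      rw [h.ncard_halfForm_of_eq hU.symm, h'.ncard_halfForm_of_lt hU'] at hMW
      push_cast at hMW
      obtain rfl : S' = 2 * S := by linarith
      obtain rfl : c = 2 * c' := mul_left_cancel₀ hS.ne' (by linarith)
      have hcc : (2 * c') ^ 2 = 4 * c' ^ 2 := by ring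
      rw [hcc] at ht hN
      exact h'.false_of_ncard_eq h hC' hU' hU.symm (fun r => (hval r).symm) (by linarith) ht' ht
        fun r => (hN r).symm
    · rw [h.ncard_halfForm_of_eq hU.symm, h'.ncard_halfForm_of_eq hU'.symm] at hMW
      push_cast at hMW
      linarith
  subst hSS
  refine ⟨mul_left_cancel₀ hS.ne' hvol, rfl, h.eq_of_ncard_eq h' hf hf' (fun r => ?_) (by linarith)⟩
  exact_mod_cast mul_left_cancel₀ hS.ne' (hM r)

end IsHalfReduced

lemma inner_of_plane {v w : EuclideanSpace ℝ (Fin 3)} (hv : v 2 = 0) :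
    ⟪v, w⟫ = v 0 * w 0 + v 1 * w 1 := by
  simp [PiLp.inner_apply, Fin.sum_univ_three, hv]
  ring

lemma norm_sq_of_plane {v : EuclideanSpace ℝ (Fin 3)} (hv : v 2 = 0) :
    ‖v‖ ^ 2 = v 0 ^ 2 + v 1 ^ 2 := by
  rw [← real_inner_self_eq_norm_sq, inner_of_plane hv]
  ring

lemma norm_sq_mul_norm_sq_sub {v w : EuclideanSpace ℝ (Fin 3)} (hv : v 2 = 0) (hw : w 2 = 0) :
    ‖v‖ ^ 2 * ‖w‖ ^ 2 - ⟪v, w⟫ ^ 2 = (v 0 * w 1 - v 1 * w 0) ^ 2 := by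
  rw [norm_sq_of_plane hv, norm_sq_of_plane hw, inner_of_plane hv]
  ring

lemma det_ne_zero_of_linearIndependent {v w : EuclideanSpace ℝ (Fin 3)} (hv : v 2 = 0)
    (hw : w 2 = 0) (h : LinearIndependent ℝ ![v, w]) : v 0 * w 1 - v 1 * w 0 ≠ 0 := by
  intro hd
  rw [LinearIndependent.pair_iff] at h
  have h0 := h (w 0) (-v 0) (by
    ext i
    fin_cases i
    · simp; ring
    · simp; linarith
    · simp [hv, hw])
  have h1 := h (w 1) (-v 1) (by
    ext i
    fin_cases i
    · simp; linarith
    · simp; ring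
    · simp [hv, hw])
  have := h 1 0 (by
    ext i
    fin_cases i
    · simpa using h0.2
    · simpa using h1.2
    · simp [hv])
  exact one_ne_zero this.1

lemma norm_sq_combination {E : Type*} [NormedAddCommGroup E] [InnerProductSpace ℝ E] {v w : E}
    (a b : ℝ) :
    ‖a • v + b • w‖ ^ 2 = a ^ 2 * ‖v‖ ^ 2 + 2 * a * b * ⟪v, w⟫ + b ^ 2 * ‖w‖ ^ 2 := by
  rw [norm_add_sq_real, norm_smul, norm_smul, real_inner_smul_left, real_inner_smul_right,
    mul_pow, mul_pow, Real.norm_eq_abs, Real.norm_eq_abs, sq_abs, sq_abs]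
  ring

/-- The trace function in terms of the quadratic forms of the two lattice sums. -/
lemma N1trace_eq {v w : EuclideanSpace ℝ (Fin 3)} (hv : v 2 = 0) (hw : w 2 = 0)
    (hvw : LinearIndependent ℝ ![v, w]) {c s : ℝ} (hc : 0 < c) (hs : 0 < s) :
    2 * π / s * N1trace v w c (1 / (4 * s)) =
      √s * ((√π)⁻¹ * (|v 0 * w 1 - v 1 * w 0| * c) * ∑' p,
        rexp (-s * torusForm (‖v‖ ^ 2 / 4) (-⟪v, w⟫ / 2) (‖w‖ ^ 2) (c ^ 2) p)) +
      |v 0 * w 1 - v 1 * w 0| * ∑' p,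
        rexp (-s * halfForm (‖v‖ ^ 2 / 4) (-⟪v, w⟫ / 2) (‖w‖ ^ 2) p) := by
  have h4 : 4 * (1 / (4 * s)) = s⁻¹ := by field_simp
  have hhalf : ∑' p : ℤ × ℤ,
      rexp (-‖((p.1 : ℝ) + 1 / 2) • v + (p.2 : ℝ) • w‖ ^ 2 / (4 * (1 / (4 * s)))) =
      ∑' p, rexp (-s * halfForm (‖v‖ ^ 2 / 4) (-⟪v, w⟫ / 2) (‖w‖ ^ 2) p) := by
    refine tsum_congr fun p => ?_
    rw [h4, norm_sq_combination, div_inv_eq_mul, halfForm]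
    ring_nf
  have hmem : ∀ p : ℤ × ℤ × ℤ, p.1 • v + p.2.1 • w + p.2.2 • (c • EuclideanSpace.single 2 1) ∈
      Submodule.span ℤ
        ({v, w, c • EuclideanSpace.single 2 1} : Set (EuclideanSpace ℝ (Fin 3))) := fun p =>
    Submodule.mem_span_triple.2 ⟨p.1, p.2.1, p.2.2, rfl⟩
  have hbij : Function.Bijective fun p : ℤ × ℤ × ℤ => (⟨_, hmem p⟩ : Submodule.span ℤ
        ({v, w, c • EuclideanSpace.single 2 1} : Set (EuclideanSpace ℝ (Fin 3)))) := by
    constructor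
    · rintro ⟨x, y, z⟩ ⟨x', y', z'⟩ h
      have h := congrArg Subtype.val h
      dsimp only at h
      have hz : z = z' := by
        have := congrArg (fun u : EuclideanSpace ℝ (Fin 3) => u 2) h
        simpa [hv, hw, hc.ne'] using this
      subst hz
      have h := add_right_cancel h
      rw [← sub_eq_zero] at h
      have := LinearIndependent.pair_iff.1 hvw (x - x' : ℤ) (y - y' : ℤ) (by
        rw [Int.cast_smul_eq_zsmul, Int.cast_smul_eq_zsmul, ← h]
        module)
      simp only [Int.cast_eq_zero, sub_eq_zero] at this
      rw [this.1, this.2]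
    · rintro ⟨u, hu⟩
      obtain ⟨x, y, z, rfl⟩ := Submodule.mem_span_triple.1 hu
      exact ⟨(x, y, z), rfl⟩
  have htorus : ∑' u : Submodule.span ℤ
        ({v, w, c • EuclideanSpace.single 2 1} : Set (EuclideanSpace ℝ (Fin 3))),
      rexp (-‖(u : EuclideanSpace ℝ (Fin 3))‖ ^ 2 / (4 * (1 / (4 * s)))) =
      ∑' p, rexp (-s * torusForm (‖v‖ ^ 2 / 4) (-⟪v, w⟫ / 2) (‖w‖ ^ 2) (c ^ 2) p) := by
    rw [← (Equiv.ofBijective _ hbij).tsum_eq]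
    refine tsum_congr fun p => ?_
    obtain ⟨x, y, z⟩ := p
    have : ‖x • v + y • w + z • (c • EuclideanSpace.single (2 : Fin 3) (1 : ℝ))‖ ^ 2 =
        torusForm (‖v‖ ^ 2 / 4) (-⟪v, w⟫ / 2) (‖w‖ ^ 2) (c ^ 2) (x, y, z) := by
      rw [EuclideanSpace.norm_sq_eq, Fin.sum_univ_three, torusForm, norm_sq_of_plane hv,
        norm_sq_of_plane hw, inner_of_plane hv]
      simp [hv, hw, mul_pow]
      ring
    rw [Equiv.ofBijective_apply, this, h4, div_inv_eq_mul]
    ring_nf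
  have hpow : (4 * π * (1 / (4 * s))) ^ ((3 : ℝ) / 2) = π * √π / (s * √s) := by
    have : 4 * π * (1 / (4 * s)) = π / s := by field_simp
    rw [this, Real.div_rpow Real.pi_pos.le hs.le]
    have aux : ∀ x : ℝ, 0 < x → x ^ ((3 : ℝ) / 2) = x * √x := fun x hx => by
      rw [Real.sqrt_eq_rpow, ← Real.rpow_one_add' hx.le (by norm_num)]
      norm_num
    rw [aux _ Real.pi_pos, aux _ hs]
  rw [N1trace, hhalf, htorus, hpow]
  have := Real.pi_pos
  have hsp : 0 < √π := Real.sqrt_pos.2 this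
  have hss : 0 < √s := Real.sqrt_pos.2 hs
  field_simp
  ring

lemma zsmul_combination_two {v w : EuclideanSpace ℝ (Fin 3)} (hv : v 2 = 0) (hw : w 2 = 0)
    (m n : ℤ) : (m • v + n • w) 2 = 0 := by
  simp [hv, hw]

lemma det_zsmul_combination (v w : EuclideanSpace ℝ (Fin 3)) (m n k l : ℤ) :
    (m • v + n • w) 0 * (k • v + l • w) 1 - (m • v + n • w) 1 * (k • v + l • w) 0 =
      (m * l - n * k : ℤ) * (v 0 * w 1 - v 1 * w 0) := by
  simp
  ring

lemma finite_norm_sq_le {v w : EuclideanSpace ℝ (Fin 3)} (hv : v 2 = 0) (hw : w 2 = 0)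
    (hd : v 0 * w 1 - v 1 * w 0 ≠ 0) (R : ℝ) :
    {p : ℤ × ℤ | ‖p.1 • v + p.2 • w‖ ^ 2 ≤ R}.Finite := by
  have hpos : 0 < ‖v‖ ^ 2 * ‖w‖ ^ 2 - ⟪v, w⟫ ^ 2 := by
    rw [norm_sq_mul_norm_sq_sub hv hw]
    positivity
  have hv0 : 0 < ‖v‖ ^ 2 := by
    by_contra! h
    nlinarith [sq_nonneg ‖v‖, sq_nonneg ‖w‖, sq_nonneg ⟪v, w⟫]
  refine (finite_le_of_summable_exp (summable_exp_binaryForm hv0 hpos one_pos) R).subset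
    fun p hp => ?_
  rw [Set.mem_ofPred_eq, ← Int.cast_smul_eq_zsmul ℝ, ← Int.cast_smul_eq_zsmul ℝ,
    norm_sq_combination] at hp
  rw [Set.mem_ofPred_eq]
  linarith

lemma exists_mul_add_abs_le {a : ℝ} (ha : 0 < a) (b : ℝ) : ∃ j : ℤ, |b + j * a| ≤ a / 2 := by
  refine ⟨-round (b / a), ?_⟩
  have h := abs_sub_round (b / a)
  have : b + (-round (b / a) : ℤ) * a = (b / a - round (b / a)) * a := by
    push_cast
    field_simp
    ring
  rw [this, abs_mul, abs_of_pos ha]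
  nlinarith

/-- A basis of a plane lattice can be changed, preserving the class of half the first vector modulo
the lattice, so that the associated form is half-reduced. -/
lemma exists_isHalfReduced {v w : EuclideanSpace ℝ (Fin 3)} (hv : v 2 = 0) (hw : w 2 = 0)
    (hd : v 0 * w 1 - v 1 * w 0 ≠ 0) :
    ∃ m n k l : ℤ, ((2 * m + 1) * l - 2 * n * k = 1 ∨ (2 * m + 1) * l - 2 * n * k = -1) ∧
      IsHalfReduced (‖(2 * m + 1) • v + (2 * n) • w‖ ^ 2 / 4)
        (-⟪(2 * m + 1) • v + (2 * n) • w, k • v + l • w⟫ / 2) (‖k • v + l • w‖ ^ 2) := by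
  let P : Set (ℤ × ℤ) := {p | ∃ k l : ℤ,
    (2 * p.1 + 1) * l - 2 * p.2 * k = 1 ∨ (2 * p.1 + 1) * l - 2 * p.2 * k = -1}
  let F : ℤ × ℤ → ℝ := fun p => ‖(2 * p.1 + 1) • v + (2 * p.2) • w‖ ^ 2
  have hinj : Function.Injective fun p : ℤ × ℤ => (2 * p.1 + 1, 2 * p.2) := by
    rintro ⟨x, y⟩ ⟨x', y'⟩ h
    simp only [Prod.mk.injEq] at h ⊢
    omega
  have hfin : (P ∩ {p | F p ≤ F (0, 0)}).Finite :=
    ((finite_norm_sq_le hv hw hd (F (0, 0))).preimage hinj.injOn).subset fun p hp => hp.2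
  obtain ⟨⟨m, n⟩, ⟨⟨k₀, l₀, h₀⟩, hmn⟩, hmin⟩ := Set.exists_min_image _ F hfin
    ⟨(0, 0), ⟨0, 1, by simp⟩, le_refl (F (0, 0))⟩
  replace hmin : ∀ p ∈ P, F (m, n) ≤ F p := fun p hp => by
    rcases le_or_gt (F p) (F (0, 0)) with h | h
    · exact hmin p ⟨hp, h⟩
    · exact le_trans hmn h.le
  dsimp only at h₀
  set a := (2 * m + 1) • v + (2 * n) • w with ha
  have ha2 : a 2 = 0 := zsmul_combination_two hv hw _ _
  have hdet : ∀ k l : ℤ,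
      ((2 * m + 1) * l - 2 * n * k = 1 ∨ (2 * m + 1) * l - 2 * n * k = -1) →
      0 < ‖a‖ ^ 2 * ‖k • v + l • w‖ ^ 2 - ⟪a, k • v + l • w⟫ ^ 2 := fun k l h => by
    rw [norm_sq_mul_norm_sq_sub ha2 (zsmul_combination_two hv hw _ _), ha, det_zsmul_combination]
    have : (((2 * m + 1) * l - 2 * n * k : ℤ) : ℝ) ≠ 0 := by
      rcases h with h | h <;> rw [h] <;> norm_num
    positivity
  have hapos : 0 < ‖a‖ ^ 2 := by
    by_contra! h
    nlinarith [hdet k₀ l₀ h₀, sq_nonneg ‖a‖, sq_nonneg ‖k₀ • v + l₀ • w‖,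
      sq_nonneg ⟪a, k₀ • v + l₀ • w⟫]
  obtain ⟨k, l, hkl, hle, hneg⟩ : ∃ k l : ℤ,
      ((2 * m + 1) * l - 2 * n * k = 1 ∨ (2 * m + 1) * l - 2 * n * k = -1) ∧
      -(‖a‖ ^ 2 / 2) ≤ ⟪a, k • v + l • w⟫ ∧ ⟪a, k • v + l • w⟫ ≤ 0 := by
    obtain ⟨j, hj⟩ := exists_mul_add_abs_le hapos ⟪a, k₀ • v + l₀ • w⟫
    have hinner : ⟪a, (k₀ + j * (2 * m + 1)) • v + (l₀ + j * (2 * n)) • w⟫ =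
        ⟪a, k₀ • v + l₀ • w⟫ + j * ‖a‖ ^ 2 := by
      rw [← real_inner_self_eq_norm_sq, ← real_inner_smul_right, ← inner_add_right]
      congr 1
      rw [Int.cast_smul_eq_zsmul, ha]
      module
    rw [← hinner, abs_le] at hj
    have hdet' : (2 * m + 1) * (l₀ + j * (2 * n)) - 2 * n * (k₀ + j * (2 * m + 1)) =
        (2 * m + 1) * l₀ - 2 * n * k₀ := by ring
    rcases le_total ⟪a, (k₀ + j * (2 * m + 1)) • v + (l₀ + j * (2 * n)) • w⟫ 0 with h | h
    · exact ⟨_, _, by rwa [hdet'], hj.1, h⟩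
    · refine ⟨-(k₀ + j * (2 * m + 1)), -(l₀ + j * (2 * n)), ?_, ?_⟩
      · have : (2 * m + 1) * -(l₀ + j * (2 * n)) - 2 * n * -(k₀ + j * (2 * m + 1)) =
          -((2 * m + 1) * l₀ - 2 * n * k₀) := by ring
        rw [this]
        rcases h₀ with h | h <;> simp [h]
      · have : (-(k₀ + j * (2 * m + 1))) • v + (-(l₀ + j * (2 * n))) • w =
            -((k₀ + j * (2 * m + 1)) • v + (l₀ + j * (2 * n)) • w) := by module
        rw [this, inner_neg_right]
        constructor <;> linarith [hj.2]
  refine ⟨m, n, k, l, hkl, by linarith, by linarith, ?_, by linarith [hdet k l hkl]⟩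
  have hP : (m + k, n + l) ∈ P := by
    refine ⟨k, l, ?_⟩
    have : (2 * (m + k) + 1) * l - 2 * (n + l) * k = (2 * m + 1) * l - 2 * n * k := by ring
    rwa [this]
  have hF : F (m + k, n + l) = ‖(1 : ℝ) • a + (2 : ℝ) • (k • v + l • w)‖ ^ 2 := by
    simp only [F, ha]
    congr 2
    rw [one_smul, two_smul]
    module
  have := hmin _ hP
  rw [hF, norm_sq_combination] at this
  change ‖a‖ ^ 2 ≤ _ at this
  linarith

lemma tsum_half_change_basis {v w : EuclideanSpace ℝ (Fin 3)} {m n k l : ℤ}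
    (hdet : (2 * m + 1) * l - 2 * n * k = 1 ∨ (2 * m + 1) * l - 2 * n * k = -1)
    (f : EuclideanSpace ℝ (Fin 3) → ℝ) :
    ∑' p : ℤ × ℤ, f (((p.1 : ℝ) + 1 / 2) • ((2 * m + 1) • v + (2 * n) • w) +
        (p.2 : ℝ) • (k • v + l • w)) =
      ∑' p : ℤ × ℤ, f (((p.1 : ℝ) + 1 / 2) • v + (p.2 : ℝ) • w) := by
  let φ : ℤ × ℤ → ℤ × ℤ := fun p =>
    (p.1 * (2 * m + 1) + m + p.2 * k, (2 * p.1 + 1) * n + p.2 * l)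
  have hd : ((2 * m + 1) * l - 2 * n * k) * ((2 * m + 1) * l - 2 * n * k) = 1 := by
    rcases hdet with h | h <;> rw [h] <;> rfl
  set d := (2 * m + 1) * l - 2 * n * k with hd'
  have hbij : Function.Bijective φ := by
    constructor
    · rintro ⟨x, y⟩ ⟨x', y'⟩ h
      simp only [φ, Prod.mk.injEq] at h ⊢
      have hd0 : d ≠ 0 := by rintro h0; simp [h0] at hd
      constructor
      · apply mul_left_cancel₀ hd0
        rw [hd']
        linear_combination l * h.1 - k * h.2
      · apply mul_left_cancel₀ hd0
        rw [hd']
        linear_combination (2 * m + 1) * h.2 - 2 * n * h.1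
    · rintro ⟨x, y⟩
      obtain ⟨l', hl⟩ : ∃ l', l = 2 * l' + 1 := by
        rcases Int.even_or_odd' l with ⟨t, rfl | rfl⟩
        · exfalso
          have h2 : d = 2 * ((2 * m + 1) * t - n * k) := by rw [hd']; ring
          omega
        · exact ⟨t, rfl⟩
      obtain ⟨e, he⟩ : ∃ e, d * (l * (2 * x + 1) - 2 * k * y) = 2 * e + 1 := by
        rcases hdet with h | h
        · exact ⟨l * x + l' - k * y, by rw [h]; linear_combination hl⟩
        · exact ⟨-(l * x + l' - k * y) - 1, by rw [h]; linear_combination -hl⟩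
      refine ⟨(e, d * ((2 * m + 1) * y - n * (2 * x + 1))), ?_⟩
      simp only [φ, Prod.mk.injEq]
      constructor
      · apply mul_left_cancel₀ (two_ne_zero (α := ℤ))
        linear_combination -(2 * m + 1) * he + (2 * x + 1) * hd - d * (2 * x + 1) * hd'
      · linear_combination -n * he + y * hd - d * y * hd'
  refine Eq.trans (tsum_congr fun p => ?_) ((Equiv.ofBijective φ hbij).tsum_eq
    fun p : ℤ × ℤ => f (((p.1 : ℝ) + 1 / 2) • v + (p.2 : ℝ) • w))
  rw [Equiv.ofBijective_apply]
  congr 1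
  simp only [φ, ← Int.cast_smul_eq_zsmul ℝ]
  push_cast
  module

lemma span_pair_eq {v w : EuclideanSpace ℝ (Fin 3)} {m n k l : ℤ}
    (hdet : m * l - n * k = 1 ∨ m * l - n * k = -1) :
    Submodule.span ℤ ({m • v + n • w, k • v + l • w} : Set (EuclideanSpace ℝ (Fin 3))) =
      Submodule.span ℤ {v, w} := by
  apply le_antisymm
  · rw [Submodule.span_le]
    rintro x (rfl | rfl)
    · exact Submodule.mem_span_pair.2 ⟨m, n, rfl⟩
    · exact Submodule.mem_span_pair.2 ⟨k, l, rfl⟩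
  · have hd : (m * l - n * k) * (m * l - n * k) = 1 := by rcases hdet with h | h <;> rw [h] <;> rfl
    set d := m * l - n * k with hd'
    rw [Submodule.span_le]
    rintro x (rfl | rfl)
    · refine Submodule.mem_span_pair.2 ⟨d * l, -d * n, ?_⟩
      rw [show (d * l) • (m • x + n • w) + (-d * n) • (k • x + l • w) =
        (d * (m * l - n * k)) • x by module, ← hd', hd, one_smul]
    · refine Submodule.mem_span_pair.2 ⟨-d * k, d * m, ?_⟩
      rw [show (-d * k) • (m • v + n • x) + (d * m) • (k • v + l • x) =
        (d * (m * l - n * k)) • x by module, ← hd', hd, one_smul]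

lemma N1trace_change_basis (v w : EuclideanSpace ℝ (Fin 3)) (c t : ℝ) {m n k l : ℤ}
    (hdet : (2 * m + 1) * l - 2 * n * k = 1 ∨ (2 * m + 1) * l - 2 * n * k = -1) :
    N1trace ((2 * m + 1) • v + (2 * n) • w) (k • v + l • w) c t = N1trace v w c t := by
  have habs : |(((2 * m + 1) * l - 2 * n * k : ℤ) : ℝ)| = 1 := by
    rcases hdet with h | h <;> rw [h] <;> simp
  have hspan : Submodule.span ℤ ({(2 * m + 1) • v + (2 * n) • w, k • v + l • w,
      c • EuclideanSpace.single 2 1} : Set (EuclideanSpace ℝ (Fin 3))) =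
      Submodule.span ℤ {v, w, c • EuclideanSpace.single 2 1} := by
    have h : ∀ a b x : EuclideanSpace ℝ (Fin 3), Submodule.span ℤ {a, b, x} =
        Submodule.span ℤ {a, b} ⊔ Submodule.span ℤ {x} := fun a b x => by
      rw [← Submodule.span_union, Set.insert_union, Set.singleton_union]
    rw [h, h, span_pair_eq hdet]
  unfold N1trace
  rw [det_zsmul_combination, abs_mul, habs, one_mul, hspan,
    tsum_half_change_basis hdet fun x => rexp (-‖x‖ ^ 2 / (4 * t))]

lemma linearIndependent_of_gram_ne_zero {E : Type*} [NormedAddCommGroup E]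
    [InnerProductSpace ℝ E] {a b : E} (h : ‖a‖ ^ 2 * ‖b‖ ^ 2 - ⟪a, b⟫ ^ 2 ≠ 0) :
    LinearIndependent ℝ ![a, b] := by
  rw [LinearIndependent.pair_iff]
  intro s t hst
  have ha := congrArg (fun x => ⟪a, x⟫) hst
  have hb := congrArg (fun x => ⟪b, x⟫) hst
  simp only [inner_add_right, real_inner_smul_right, inner_zero_right,
    real_inner_self_eq_norm_sq, real_inner_comm a b] at ha hb
  constructor
  · refine (mul_eq_zero.1 ?_).resolve_right h
    linear_combination ‖b‖ ^ 2 * ha - ⟪a, b⟫ * hb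
  · refine (mul_eq_zero.1 ?_).resolve_right h
    linear_combination ‖a‖ ^ 2 * hb - ⟪a, b⟫ * ha

lemma exists_linearIsometryEquiv_of_gram_eq {a b a' b' : EuclideanSpace ℝ (Fin 2)}
    (h : LinearIndependent ℝ ![a, b]) (ha : ‖a‖ ^ 2 = ‖a'‖ ^ 2) (hab : ⟪a, b⟫ = ⟪a', b'⟫)
    (hb : ‖b‖ ^ 2 = ‖b'‖ ^ 2) :
    ∃ O : EuclideanSpace ℝ (Fin 2) ≃ₗᵢ[ℝ] EuclideanSpace ℝ (Fin 2), O a = a' ∧ O b = b' := by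
  let B := basisOfLinearIndependentOfCardEqFinrank h (by simp)
  have hB : ⇑B = ![a, b] := coe_basisOfLinearIndependentOfCardEqFinrank h (by simp)
  let T := B.constr ℝ ![a', b']
  have hTa : T a = a' := by
    have := B.constr_basis ℝ ![a', b'] 0
    rwa [hB] at this
  have hTb : T b = b' := by
    have := B.constr_basis ℝ ![a', b'] 1
    rwa [hB] at this
  have hT : ∀ x, ‖T x‖ = ‖x‖ := fun x => by
    have hx : x = B.repr x 0 • a + B.repr x 1 • b := by
      conv_lhs => rw [← B.sum_repr x, Fin.sum_univ_two, hB]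
      rfl
    rw [← sq_eq_sq₀ (norm_nonneg _) (norm_nonneg _), hx, map_add, map_smul, map_smul, hTa, hTb,
      norm_sq_combination, norm_sq_combination, ha, hab, hb]
  exact ⟨LinearIsometry.toLinearIsometryEquiv ⟨T, hT⟩ rfl, hTa, hTb⟩

lemma planeProj_combination (r s : ℝ) (v w : EuclideanSpace ℝ (Fin 3)) :
    planeProj (r • v + s • w) = r • planeProj v + s • planeProj w := by
  ext i
  fin_cases i <;> simp [planeProj]

lemma inner_planeProj {v : EuclideanSpace ℝ (Fin 3)} (hv : v 2 = 0)
    (w : EuclideanSpace ℝ (Fin 3)) : ⟪planeProj v, planeProj w⟫ = ⟪v, w⟫ := by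
  rw [inner_of_plane hv, PiLp.inner_apply, Fin.sum_univ_two]
  simp [planeProj]
  ring

lemma norm_sq_planeProj {v : EuclideanSpace ℝ (Fin 3)} (hv : v 2 = 0) :
    ‖planeProj v‖ ^ 2 = ‖v‖ ^ 2 := by
  rw [← real_inner_self_eq_norm_sq, inner_planeProj hv, real_inner_self_eq_norm_sq]

lemma exists_linearIsometryEquiv_planeProj {v w v' w' : EuclideanSpace ℝ (Fin 3)}
    (hv : v 2 = 0) (hw : w 2 = 0) (hv' : v' 2 = 0) (hw' : w' 2 = 0)
    (hd : v 0 * w 1 - v 1 * w 0 ≠ 0) (hvv : ‖v‖ ^ 2 = ‖v'‖ ^ 2) (hvw : ⟪v, w⟫ = ⟪v', w'⟫)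
    (hww : ‖w‖ ^ 2 = ‖w'‖ ^ 2) :
    ∃ O : EuclideanSpace ℝ (Fin 2) ≃ₗᵢ[ℝ] EuclideanSpace ℝ (Fin 2), ∀ r s : ℝ,
      O (planeProj (r • v + s • w)) = planeProj (r • v' + s • w') := by
  have hind : LinearIndependent ℝ ![planeProj v, planeProj w] := by
    apply linearIndependent_of_gram_ne_zero
    rw [norm_sq_planeProj hv, norm_sq_planeProj hw, inner_planeProj hv,
      norm_sq_mul_norm_sq_sub hv hw]
    exact pow_ne_zero 2 hd
  obtain ⟨O, hOv, hOw⟩ := exists_linearIsometryEquiv_of_gram_eq (a' := planeProj v')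
    (b' := planeProj w') hind
    (by rw [norm_sq_planeProj hv, norm_sq_planeProj hv', hvv])
    (by rw [inner_planeProj hv, inner_planeProj hv', hvw])
    (by rw [norm_sq_planeProj hw, norm_sq_planeProj hw', hww])
  refine ⟨O, fun r s => ?_⟩
  rw [planeProj_combination, planeProj_combination, map_add, map_smul, map_smul, hOv, hOw]

/-- An isospectral pair given by bases whose associated forms are half-reduced has equal orthogonal
lengths and equal Gram matrices. -/
lemma gram_eq_of_N1trace_eq {v w v' w' : EuclideanSpace ℝ (Fin 3)} {c c' : ℝ}
    (hv : v 2 = 0) (hw : w 2 = 0) (hv' : v' 2 = 0) (hw' : w' 2 = 0)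
    (hd : v 0 * w 1 - v 1 * w 0 ≠ 0) (hd' : v' 0 * w' 1 - v' 1 * w' 0 ≠ 0)
    (hc : 0 < c) (hc' : 0 < c')
    (h : IsHalfReduced (‖v‖ ^ 2 / 4) (-⟪v, w⟫ / 2) (‖w‖ ^ 2))
    (h' : IsHalfReduced (‖v'‖ ^ 2 / 4) (-⟪v', w'⟫ / 2) (‖w'‖ ^ 2))
    (heq : ∀ t : ℝ, 0 < t → N1trace v w c t = N1trace v' w' c' t) :
    c = c' ∧ ‖v‖ ^ 2 = ‖v'‖ ^ 2 ∧ ⟪v, w⟫ = ⟪v', w'⟫ ∧ ‖w‖ ^ 2 = ‖w'‖ ^ 2 := by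
  have hgram := norm_sq_mul_norm_sq_sub hv hw
  have hgram' := norm_sq_mul_norm_sq_sub hv' hw'
  have hind : LinearIndependent ℝ ![v, w] :=
    linearIndependent_of_gram_ne_zero (by rw [hgram]; exact pow_ne_zero 2 hd)
  have hind' : LinearIndependent ℝ ![v', w'] :=
    linearIndependent_of_gram_ne_zero (by rw [hgram']; exact pow_ne_zero 2 hd')
  obtain ⟨h1, h2, h3, h4⟩ := h.eq_of_theta_eq h' hc hc' (abs_pos.2 hd) (abs_pos.2 hd')
    (by rw [sq_abs, ← hgram]; ring) (by rw [sq_abs, ← hgram']; ring)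
    (inv_ne_zero (Real.sqrt_pos.2 Real.pi_pos).ne') fun s hs => by
      rw [← N1trace_eq hv hw hind hc hs, ← N1trace_eq hv' hw' hind' hc' hs,
        heq _ (by positivity)]
  exact ⟨h1, by linarith, by linarith, h4⟩

end

/-- Case `N₁` of Theorem B: two flat 3-manifolds of type `N₁` with equal trace functions are
isometric: they have the same orthogonal length `c`, and there is a linear isometry of `ℝ²`
carrying one plane lattice onto the other and matching the half points `v₁/2` modulo the
lattice. -/
theorem N1_isospectral_implies_isometric
    (v₁ v₂ v₁' v₂' : EuclideanSpace ℝ (Fin 3)) (c c' : ℝ)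
    (hp1 : v₁ 2 = 0) (hp2 : v₂ 2 = 0) (hp1' : v₁' 2 = 0) (hp2' : v₂' 2 = 0)
    (hind : LinearIndependent ℝ ![v₁, v₂]) (hind' : LinearIndependent ℝ ![v₁', v₂'])
    (hc : 0 < c) (hc' : 0 < c')
    (heq : ∀ t : ℝ, 0 < t → N1trace v₁ v₂ c t = N1trace v₁' v₂' c' t) :
    c = c' ∧ ∃ O : EuclideanSpace ℝ (Fin 2) ≃ₗᵢ[ℝ] EuclideanSpace ℝ (Fin 2),
      O '' (planeProj ''
          (Submodule.span ℤ ({v₁, v₂} : Set (EuclideanSpace ℝ (Fin 3))) :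
            Set (EuclideanSpace ℝ (Fin 3)))) =
        planeProj ''
          (Submodule.span ℤ ({v₁', v₂'} : Set (EuclideanSpace ℝ (Fin 3))) :
            Set (EuclideanSpace ℝ (Fin 3))) ∧
      ∃ u ∈ Submodule.span ℤ ({v₁', v₂'} : Set (EuclideanSpace ℝ (Fin 3))),
        O (planeProj ((1/2 : ℝ) • v₁)) = planeProj ((1/2 : ℝ) • v₁' + u) := by
  have hd := det_ne_zero_of_linearIndependent hp1 hp2 hind
  have hd' := det_ne_zero_of_linearIndependent hp1' hp2' hind'
  obtain ⟨m, n, k, l, hdet, hred⟩ := exists_isHalfReduced hp1 hp2 hd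
  obtain ⟨m', n', k', l', hdet', hred'⟩ := exists_isHalfReduced hp1' hp2' hd'
  have hspan := span_pair_eq (v := v₁) (w := v₂) hdet
  have hspan' := span_pair_eq (v := v₁') (w := v₂') hdet'
  have hne : ∀ {j : ℤ} {x : ℝ}, j = 1 ∨ j = -1 → x ≠ 0 → (j : ℝ) * x ≠ 0 := by
    rintro j x (rfl | rfl) hx <;> simpa using hx
  have hda := (det_zsmul_combination v₁ v₂ (2 * m + 1) (2 * n) k l).symm ▸ hne hdet hd
  have hda' := (det_zsmul_combination v₁' v₂' (2 * m' + 1) (2 * n') k' l').symm ▸ hne hdet' hd'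
  have ha2 := zsmul_combination_two hp1 hp2 (2 * m + 1) (2 * n)
  have hb2 := zsmul_combination_two hp1 hp2 k l
  have ha2' := zsmul_combination_two hp1' hp2' (2 * m' + 1) (2 * n')
  have hb2' := zsmul_combination_two hp1' hp2' k' l'
  obtain ⟨hcc, haa, hab, hbb⟩ := gram_eq_of_N1trace_eq ha2 hb2 ha2' hb2' hda hda' hc hc' hred hred'
    fun t ht => by rw [N1trace_change_basis _ _ _ _ hdet, N1trace_change_basis _ _ _ _ hdet',
      heq t ht]
  obtain ⟨O, hO⟩ := exists_linearIsometryEquiv_planeProj ha2 hb2 ha2' hb2' hda haa hab hbb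
  have hOz : ∀ x y : ℤ,
      O (planeProj (x • ((2 * m + 1) • v₁ + (2 * n) • v₂) + y • (k • v₁ + l • v₂))) =
        planeProj (x • ((2 * m' + 1) • v₁' + (2 * n') • v₂') + y • (k' • v₁' + l' • v₂')) :=
    fun x y => by simpa only [Int.cast_smul_eq_zsmul] using hO x y
  refine ⟨hcc, O, ?_, ?_⟩
  · rw [← hspan, ← hspan', Set.image_image]
    ext u
    simp only [Set.mem_image, SetLike.mem_coe, Submodule.mem_span_pair]
    constructor
    · rintro ⟨_, ⟨x, y, rfl⟩, rfl⟩
      exact ⟨_, ⟨x, y, rfl⟩, (hOz x y).symm⟩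
    · rintro ⟨_, ⟨x, y, rfl⟩, rfl⟩
      exact ⟨_, ⟨x, y, rfl⟩, hOz x y⟩
  · have hmem : m • v₁ + n • v₂ ∈ Submodule.span ℤ
        ({(2 * m + 1) • v₁ + (2 * n) • v₂, k • v₁ + l • v₂} : Set (EuclideanSpace ℝ (Fin 3))) := by
      rw [hspan]
      exact Submodule.mem_span_pair.2 ⟨m, n, rfl⟩
    obtain ⟨x, y, hxy⟩ := Submodule.mem_span_pair.1 hmem
    refine ⟨m' • v₁' + n' • v₂' -
      (x • ((2 * m' + 1) • v₁' + (2 * n') • v₂') + y • (k' • v₁' + l' • v₂')), ?_, ?_⟩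
    · refine Submodule.sub_mem _ (Submodule.mem_span_pair.2 ⟨m', n', rfl⟩) ?_
      rw [← hspan']
      exact Submodule.mem_span_pair.2 ⟨x, y, rfl⟩
    · have h1 : (1 / 2 : ℝ) • v₁ = (1 / 2 - x : ℝ) • ((2 * m + 1) • v₁ + (2 * n) • v₂) +
          (-y : ℝ) • (k • v₁ + l • v₂) := by
        have : (1 / 2 : ℝ) • v₁ = (1 / 2 : ℝ) • ((2 * m + 1) • v₁ + (2 * n) • v₂) -
            (m • v₁ + n • v₂) := by
          simp only [← Int.cast_smul_eq_zsmul ℝ]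
          push_cast
          module
        rw [this, ← hxy]
        simp only [← Int.cast_smul_eq_zsmul ℝ]
        module
      rw [h1, hO]
      congr 1
      simp only [← Int.cast_smul_eq_zsmul ℝ]
      push_cast
      module
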